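/- Let X and Y be pointed metric spaces and 0 < p < s < 1. Then a Lipschitz map T : X → Y is Lipschitz (p,m^L(p;p))-summing if and only if it is Lipschitz (s,m^L(s;s))-summing; that is, the classes of Lipschitz p-summing and Lipschitz s-summing maps from X to Y coincide for 0 < p < s < 1. -/

import Mathlib

open MeasureTheory ENNReal NNReal

noncomputable section

/-- The closed unit ball `B_{X^#}` of the Lipschitz dual of a pointed metric space `(X, x₀)`:
all Lipschitz functions `f : X → ℝ` with `f x₀ = 0` and Lipschitz constant at most `1`. -/
def dualBall (X : Type*) [MetricSpace X] (x₀ : X) : Set (X → ℝ) :=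
  {f | LipschitzWith 1 f ∧ f x₀ = 0}

/-- The strong `ℓ_p` norm `‖(σ,x',x'')|ℓ_p‖ = (Σ_j |σ_j|^p d(x'_j,x''_j)^p)^{1/p}`
(with the sup for `p = ∞`). -/
def strongNorm {X : Type*} [MetricSpace X] (p : ℝ≥0∞) {m : ℕ}
    (σ : Fin m → ℝ) (x' x'' : Fin m → X) : ℝ≥0∞ :=
  eLpNorm (fun j => σ j * dist (x' j) (x'' j)) p Measure.count

/-- The weak Lipschitz `ℓ_p` norm
`‖(σ,x',x'')|ℓ_p^{L,w}‖ = sup_{f ∈ B_{X^#}} (Σ_j |σ_j|^p |f(x'_j) - f(x''_j)|^p)^{1/p}`. -/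
def weakNorm {X : Type*} [MetricSpace X] (x₀ : X) (p : ℝ≥0∞) {m : ℕ}
    (σ : Fin m → ℝ) (x' x'' : Fin m → X) : ℝ≥0∞ :=
  ⨆ f ∈ dualBall X x₀, eLpNorm (fun j => σ j * (f (x' j) - f (x'' j))) p Measure.count

/-- The `q`-conjugate index `s'(q)`, determined by `1/s'(q) = 1/q - 1/s`. -/
def conjIdx (q s : ℝ≥0∞) : ℝ≥0∞ := (1 / q - 1 / s)⁻¹

/-- The Lipschitz mixed `(s;q)`-norm
`m^L_{(s;q)}(σ,x',x'') = inf ‖τ|ℓ_{s'(q)}‖ ⬝ ‖(σ/τ,x',x'')|ℓ_s^{L,w}‖`,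
the infimum over all finite sequences `τ` of nonzero reals. -/
def mixedNorm {X : Type*} [MetricSpace X] (x₀ : X) (s q : ℝ≥0∞) {m : ℕ}
    (σ : Fin m → ℝ) (x' x'' : Fin m → X) : ℝ≥0∞ :=
  ⨅ (τ : Fin m → ℝ) (_ : ∀ j, τ j ≠ 0),
    eLpNorm τ (conjIdx q s) Measure.count * weakNorm x₀ s (fun j => σ j / τ j) x' x''

/-- `T` is Lipschitz `(m^L(s;q),p)`-summing:
`m^L_{(s;q)}(σ,Tx',Tx'') ≤ C ⬝ ‖(σ,x',x'')|ℓ_p^{L,w}‖` for all finite sequences. -/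
def LipMixedP {X Y : Type*} [MetricSpace X] [MetricSpace Y] (x₀ : X) (y₀ : Y)
    (s q p : ℝ≥0∞) (T : X → Y) : Prop :=
  ∃ C : ℝ≥0, ∀ (m : ℕ) (σ : Fin m → ℝ) (x' x'' : Fin m → X),
    mixedNorm y₀ s q σ (T ∘ x') (T ∘ x'') ≤ C * weakNorm x₀ p σ x' x''

/-- The norm `π^L_{(m^L(s;q),p)}(T)`, the least constant in the defining inequality. -/
def lipMixedPNorm {X Y : Type*} [MetricSpace X] [MetricSpace Y] (x₀ : X) (y₀ : Y)
    (s q p : ℝ≥0∞) (T : X → Y) : ℝ≥0∞ :=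
  sInf {C : ℝ≥0∞ | ∀ (m : ℕ) (σ : Fin m → ℝ) (x' x'' : Fin m → X),
    mixedNorm y₀ s q σ (T ∘ x') (T ∘ x'') ≤ C * weakNorm x₀ p σ x' x''}

/-- `T` is Lipschitz `(p,m^L(s;q))`-summing:
`‖(σ,Tx',Tx'')|ℓ_p‖ ≤ C ⬝ m^L_{(s;q)}(σ,x',x'')` for all finite sequences. -/
def LipPMixed {X Y : Type*} [MetricSpace X] [MetricSpace Y] (x₀ : X)
    (p s q : ℝ≥0∞) (T : X → Y) : Prop :=
  ∃ C : ℝ≥0, ∀ (m : ℕ) (σ : Fin m → ℝ) (x' x'' : Fin m → X),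
    strongNorm p σ (T ∘ x') (T ∘ x'') ≤ C * mixedNorm x₀ s q σ x' x''

/-- The norm `π^L_{(p,m^L(s;q))}(T)`, the least constant in the defining inequality. -/
def lipPMixedNorm {X Y : Type*} [MetricSpace X] [MetricSpace Y] (x₀ : X)
    (p s q : ℝ≥0∞) (T : X → Y) : ℝ≥0∞ :=
  sInf {C : ℝ≥0∞ | ∀ (m : ℕ) (σ : Fin m → ℝ) (x' x'' : Fin m → X),
    strongNorm p σ (T ∘ x') (T ∘ x'') ≤ C * mixedNorm x₀ s q σ x' x''}

/-- The Lipschitz constant of a map, as an element of `ℝ≥0∞` (equal to `∞` if the map is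
not Lipschitz). -/
def lipConst {α β : Type*} [PseudoEMetricSpace α] [PseudoEMetricSpace β] (f : α → β) : ℝ≥0∞ :=
  ⨅ (K : ℝ≥0) (_ : LipschitzWith K f), (K : ℝ≥0∞)



/-- Real-variable form of the summing inequality. -/
def PS {X Y : Type*} [MetricSpace X] [MetricSpace Y] (x₀ : X) (q C : ℝ) (T : X → Y) : Prop :=
  ∀ (m : ℕ) (v : Fin m → ℝ) (x' x'' : Fin m → X) (W : ℝ), (∀ j, 0 ≤ v j) →
    (∀ f ∈ dualBall X x₀, ∑ j, v j * |f (x' j) - f (x'' j)| ^ q ≤ W) →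
    ∑ j, v j * dist (T (x' j)) (T (x'' j)) ^ q ≤ C * W

lemma zero_mem_dualBall {X : Type*} [MetricSpace X] (x₀ : X) :
    (fun _ => (0 : ℝ)) ∈ dualBall X x₀ :=
  ⟨(LipschitzWith.const 0).weaken zero_le_one, rfl⟩

/-- Finite Pietsch domination. -/
lemma pietsch {X Y : Type*} [MetricSpace X] [MetricSpace Y] (x₀ : X) (q C : ℝ) (hC : 0 < C)
    (T : X → Y) (h : PS x₀ q C T) (m : ℕ) (x' x'' : Fin m → X) :
    ∃ (ι : Type) (_ : Fintype ι) (μ : ι → ℝ) (f : ι → X → ℝ), (∀ i, 0 ≤ μ i) ∧ ∑ i, μ i = 1 ∧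
      (∀ i, f i ∈ dualBall X x₀) ∧
      ∀ j, dist (T (x' j)) (T (x'' j)) ^ q ≤
        2 * C * ∑ i, μ i * |f i (x' j) - f i (x'' j)| ^ q := by
  classical
  set D : Fin m → ℝ := fun j => dist (T (x' j)) (T (x'' j)) ^ q with hD
  have hD0 : ∀ j, 0 ≤ D j := fun j => Real.rpow_nonneg dist_nonneg _
  set t : Fin m → ℝ := fun j => if D j = 0 then -1 else D j / 2 with ht
  have htD : ∀ j, t j < D j := by
    intro j
    simp only [ht]
    split_ifs with h0
    · rw [h0]; norm_num
    · have := lt_of_le_of_ne (hD0 j) (Ne.symm h0); linarith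
  have htD2 : ∀ j (y : ℝ), 0 ≤ y → t j < y → D j ≤ 2 * y := by
    intro j y hy
    simp only [ht]
    split_ifs with h0
    · intro _; rw [h0]; linarith
    · intro h; linarith
  set ev : (X → ℝ) → (Fin m → ℝ) := fun f j => |f (x' j) - f (x'' j)| ^ q with hev
  set A : Set (Fin m → ℝ) := convexHull ℝ (ev '' dualBall X x₀) with hA
  set U : Set (Fin m → ℝ) := Set.univ.pi (fun j => Set.Ioi (t j / C)) with hU
  have hUo : IsOpen U := isOpen_set_pi Set.finite_univ (fun _ _ => isOpen_Ioi)
  have hUc : Convex ℝ U := convex_pi (fun _ _ => convex_Ioi _)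
  by_cases hdis : Disjoint U A
  · exfalso
    obtain ⟨l, u, h1, h2⟩ := geometric_hahn_banach_open hUc hUo (convex_convexHull ℝ _) hdis
    set e : Fin m → ℝ := fun j => l (fun k => if j = k then 1 else 0) with he
    have hl : ∀ x : Fin m → ℝ, l x = ∑ j, x j * e j := by
      intro x
      have := LinearMap.pi_apply_eq_sum_univ (l : (Fin m → ℝ) →ₗ[ℝ] ℝ) x
      simpa [he] using this
    have hDU : (fun j => D j / C) ∈ U := by
      intro j _
      exact div_lt_div_of_pos_right (htD j) hC
    have he0 : ∀ j, e j ≤ 0 := by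
      intro j
      by_contra hj
      push Not at hj
      set r : ℝ := |u - l (fun j => D j / C)| / e j with hr
      have hr0 : 0 ≤ r := by positivity
      have hm : (fun k => D k / C) + r • (fun k => if j = k then (1:ℝ) else 0) ∈ U := by
        intro k hk
        have h3 := hDU k hk
        simp only [Set.mem_Ioi, Pi.add_apply, Pi.smul_apply, smul_eq_mul] at h3 ⊢
        have : 0 ≤ r * (if j = k then (1:ℝ) else 0) := by split_ifs <;> simp [hr0]
        linarith
      have h3 := h1 _ hm
      rw [map_add, map_smul, smul_eq_mul] at h3
      change _ + r * e j < u at h3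
      rw [hr, div_mul_cancel₀ _ hj.ne'] at h3
      have := le_abs_self (u - l (fun j => D j / C))
      linarith
    have h4 := h m (fun j => - e j) x' x'' (-u) (fun j => by have := he0 j; simpa using this) (by
      intro f hf
      have h5 := h2 (ev f) (subset_convexHull ℝ _ ⟨f, hf, rfl⟩)
      rw [hl] at h5
      have : ∑ j, - e j * |f (x' j) - f (x'' j)| ^ q = - ∑ j, ev f j * e j := by
        rw [← Finset.sum_neg_distrib]
        exact Finset.sum_congr rfl (fun j _ => by simp only [hev]; ring)
      linarith)
    have h6 := h1 _ hDU
    rw [hl] at h6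
    have h7 : ∑ j, - e j * dist (T (x' j)) (T (x'' j)) ^ q = - (C * ∑ j, D j / C * e j) := by
      rw [Finset.mul_sum, ← Finset.sum_neg_distrib]
      refine Finset.sum_congr rfl (fun j _ => ?_)
      simp only [hD]; field_simp
    rw [h7] at h4
    nlinarith
  · rw [Set.not_disjoint_iff] at hdis
    obtain ⟨a, haU, haA⟩ := hdis
    obtain ⟨κ, _, w, z, hw, hw1, hz, hza⟩ := mem_convexHull_iff_exists_fintype.1 haA
    choose f hf hfz using hz
    refine ⟨κ, inferInstance, w, f, hw, hw1, hf, fun j => ?_⟩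
    have h1 : t j < C * a j := by
      have := haU j (Set.mem_univ j)
      rw [Set.mem_Ioi, div_lt_iff₀ hC] at this
      linarith
    have h2 : a j = ∑ i, w i * |f i (x' j) - f i (x'' j)| ^ q := by
      rw [← hza, Finset.sum_apply]
      refine Finset.sum_congr rfl (fun i _ => ?_)
      rw [← hfz]
      rfl
    have h3 : 0 ≤ a j := by
      rw [h2]
      exact Finset.sum_nonneg (fun i _ => mul_nonneg (hw i) (Real.rpow_nonneg (abs_nonneg _) _))
    rw [← h2, mul_assoc]
    exact htD2 j _ (mul_nonneg hC.le h3) h1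

lemma eLp_count {m : ℕ} (p : ℝ≥0∞) (hp : p ≠ 0) (hp' : p ≠ ∞) (u : Fin m → ℝ) :
    eLpNorm u p Measure.count = ENNReal.ofReal ((∑ j, |u j| ^ p.toReal) ^ (1 / p.toReal)) := by
  have hq : 0 < p.toReal := ENNReal.toReal_pos hp hp'
  rw [eLpNorm_eq_lintegral_rpow_enorm_toReal hp hp', lintegral_count, tsum_fintype,
    ← ENNReal.ofReal_rpow_of_nonneg
      (Finset.sum_nonneg fun j _ => Real.rpow_nonneg (abs_nonneg _) _) (by positivity),
    ENNReal.ofReal_sum_of_nonneg (fun j _ => Real.rpow_nonneg (abs_nonneg _) _)]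
  congr 1
  refine Finset.sum_congr rfl (fun j _ => ?_)
  rw [← ENNReal.ofReal_rpow_of_nonneg (abs_nonneg _) hq.le, Real.enorm_eq_ofReal_abs]

lemma conjIdx_self (p : ℝ≥0∞) : conjIdx p p = ∞ := by
  simp [conjIdx]

lemma mixed_le {X : Type*} [MetricSpace X] (x₀ : X) (p : ℝ≥0∞) {m : ℕ}
    (σ : Fin m → ℝ) (x' x'' : Fin m → X) :
    mixedNorm x₀ p p σ x' x'' ≤ weakNorm x₀ p σ x' x'' := by
  refine (iInf₂_le (fun _ => (1 : ℝ)) (fun _ => one_ne_zero)).trans ?_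
  rw [conjIdx_self, eLpNorm_exponent_top, eLpNormEssSup_count]
  simp only [div_one]
  have h1 : (⨆ _ : Fin m, ‖(1 : ℝ)‖ₑ) ≤ 1 := iSup_le (fun _ => by simp)
  calc _ ≤ 1 * weakNorm x₀ p σ x' x'' := by gcongr
    _ = _ := one_mul _

lemma le_mixed {X : Type*} [MetricSpace X] (x₀ : X) (p : ℝ≥0∞) {m : ℕ}
    (σ : Fin m → ℝ) (x' x'' : Fin m → X) :
    weakNorm x₀ p σ x' x'' ≤ mixedNorm x₀ p p σ x' x'' := by
  refine le_iInf₂ (fun τ hτ => ?_)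
  rw [conjIdx_self, eLpNorm_exponent_top, eLpNormEssSup_count]
  refine iSup₂_le (fun f hf => ?_)
  have hfin : (⨆ a, ‖τ a‖ₑ) ≠ ∞ := by
    have : (⨆ a, ‖τ a‖ₑ) ≤ ∑ a, ‖τ a‖ₑ :=
      iSup_le (fun a => Finset.single_le_sum (f := fun a => ‖τ a‖ₑ) (fun _ _ => zero_le) (Finset.mem_univ a))
    exact ne_top_of_le_ne_top (ENNReal.sum_ne_top.2 (fun a _ => enorm_ne_top)) this
  set c : ℝ≥0 := (⨆ a, ‖τ a‖ₑ).toNNReal with hc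
  have hcc : (c : ℝ≥0∞) = ⨆ a, ‖τ a‖ₑ := ENNReal.coe_toNNReal hfin
  rw [← hcc]
  have h1 : eLpNorm (fun j => σ j * (f (x' j) - f (x'' j))) p Measure.count ≤
      c • eLpNorm (fun j => σ j / τ j * (f (x' j) - f (x'' j))) p Measure.count := by
    refine eLpNorm_le_nnreal_smul_eLpNorm_of_ae_le_mul (Filter.Eventually.of_forall fun j => ?_) p
    have h2 : ‖τ j‖₊ ≤ c := by
      rw [← ENNReal.coe_le_coe, hcc]
      exact le_iSup (fun a => ‖τ a‖ₑ) j
    have h3 : σ j * (f (x' j) - f (x'' j)) = τ j * (σ j / τ j * (f (x' j) - f (x'' j))) := by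
      have := hτ j
      field_simp
    rw [h3, nnnorm_mul]
    gcongr
  refine h1.trans ?_
  rw [ENNReal.smul_def, smul_eq_mul]
  gcongr
  exact le_iSup₂ (f := fun f (_ : f ∈ dualBall X x₀) => eLpNorm (fun j => σ j / τ j * (f (x' j) - f (x'' j))) p Measure.count) f hf

lemma lip_iff {X Y : Type*} [MetricSpace X] [MetricSpace Y] (x₀ : X) (p : ℝ≥0∞)
    (hp : p ≠ 0) (hp' : p ≠ ∞) (T : X → Y) :
    LipPMixed x₀ p p p T ↔ ∃ C : ℝ, 0 < C ∧ PS x₀ p.toReal C T := by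
  have hq : 0 < p.toReal := ENNReal.toReal_pos hp hp'
  set q := p.toReal with hqd
  have key : ∀ (x y : ℝ), 0 ≤ x → 0 ≤ y → |x ^ (1 / q) * y| ^ q = x * y ^ q := by
    intro x y hx hy
    rw [abs_of_nonneg (by positivity), Real.mul_rpow (by positivity) hy, ← Real.rpow_mul hx,
      one_div_mul_cancel hq.ne', Real.rpow_one]
  constructor
  · rintro ⟨C, hC⟩
    refine ⟨((C : ℝ) + 1) ^ q, by positivity, ?_⟩
    intro m v x' x'' W hv hW
    have hW0 : 0 ≤ W := by
      have := hW _ (zero_mem_dualBall x₀)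
      simpa [Real.zero_rpow hq.ne'] using this
    have h1 := (hC m (fun j => v j ^ (1 / q)) x' x'').trans
      (mul_le_mul_right (mixed_le x₀ p _ x' x'') _)
    have h2 : weakNorm x₀ p (fun j => v j ^ (1 / q)) x' x'' ≤ ENNReal.ofReal (W ^ (1 / q)) := by
      refine iSup₂_le (fun f hf => ?_)
      rw [eLp_count p hp hp']
      refine ENNReal.ofReal_le_ofReal ?_
      refine Real.rpow_le_rpow (Finset.sum_nonneg fun j _ => Real.rpow_nonneg (abs_nonneg _) _)
        ?_ (by positivity)
      refine le_trans (le_of_eq (Finset.sum_congr rfl fun j _ => ?_)) (hW f hf)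
      rw [← key _ _ (hv j) (abs_nonneg _), abs_mul, abs_mul, abs_abs]
    have h3 := h1.trans (mul_le_mul_right h2 _)
    rw [strongNorm, eLp_count p hp hp', ← ENNReal.ofReal_coe_nnreal,
      ← ENNReal.ofReal_mul (by positivity), ENNReal.ofReal_le_ofReal_iff (by positivity)] at h3
    have h4 : ∑ j, |v j ^ (1 / q) * dist ((T ∘ x') j) ((T ∘ x'') j)| ^ q =
        ∑ j, v j * dist (T (x' j)) (T (x'' j)) ^ q :=
      Finset.sum_congr rfl fun j _ => key _ _ (hv j) dist_nonneg
    rw [← hqd, h4] at h3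
    have h0 : 0 ≤ ∑ j, v j * dist (T (x' j)) (T (x'' j)) ^ q :=
      Finset.sum_nonneg fun j _ => mul_nonneg (hv j) (Real.rpow_nonneg dist_nonneg _)
    have h5 := Real.rpow_le_rpow (by positivity) h3 hq.le
    rw [← Real.rpow_mul h0, one_div_mul_cancel hq.ne', Real.rpow_one,
      Real.mul_rpow (by positivity) (by positivity), ← Real.rpow_mul hW0,
      one_div_mul_cancel hq.ne', Real.rpow_one] at h5
    refine h5.trans ?_
    gcongr
    linarith
  · rintro ⟨C, hC, h⟩
    refine ⟨(C ^ (1 / q)).toNNReal, fun m σ x' x'' => ?_⟩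
    refine le_trans ?_ (mul_le_mul_right (le_mixed x₀ p σ x' x'') _)
    have hCp : 0 < C ^ (1 / q) := by positivity
    by_cases htop : weakNorm x₀ p σ x' x'' = ∞
    · rw [htop, ENNReal.mul_top]
      · exact le_top
      · simpa using hCp
    obtain ⟨w, hw⟩ : ∃ w : ℝ≥0, weakNorm x₀ p σ x' x'' = w := ⟨_, (ENNReal.coe_toNNReal htop).symm⟩
    have h1 := h m (fun j => |σ j| ^ q) x' x'' ((w : ℝ) ^ q) (fun j => by positivity) (by
      intro f hf
      have h2 : eLpNorm (fun j => σ j * (f (x' j) - f (x'' j))) p Measure.count ≤ w := by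
        rw [← hw]
        exact le_iSup₂ (f := fun f (_ : f ∈ dualBall X x₀) =>
          eLpNorm (fun j => σ j * (f (x' j) - f (x'' j))) p Measure.count) f hf
      rw [eLp_count p hp hp', ← ENNReal.ofReal_coe_nnreal,
        ENNReal.ofReal_le_ofReal_iff (by positivity), ← hqd] at h2
      have h0 : 0 ≤ ∑ j, |σ j * (f (x' j) - f (x'' j))| ^ q :=
        Finset.sum_nonneg fun j _ => Real.rpow_nonneg (abs_nonneg _) _
      have h3 := Real.rpow_le_rpow (by positivity) h2 hq.le
      rw [← Real.rpow_mul h0, one_div_mul_cancel hq.ne', Real.rpow_one] at h3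
      refine le_trans (le_of_eq (Finset.sum_congr rfl fun j _ => ?_)) h3
      rw [abs_mul, Real.mul_rpow (abs_nonneg _) (abs_nonneg _)])
    rw [hw, strongNorm, eLp_count p hp hp', ← ENNReal.ofReal_coe_nnreal (p := w), ← hqd]
    change _ ≤ ENNReal.ofReal (C ^ (1 / q)) * _
    rw [← ENNReal.ofReal_mul (by positivity)]
    refine ENNReal.ofReal_le_ofReal ?_
    have h4 : ∑ j, |σ j * dist ((T ∘ x') j) ((T ∘ x'') j)| ^ q =
        ∑ j, |σ j| ^ q * dist (T (x' j)) (T (x'' j)) ^ q :=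
      Finset.sum_congr rfl fun j _ => by
        rw [abs_mul, Real.mul_rpow (abs_nonneg _) (abs_nonneg _), abs_of_nonneg dist_nonneg]; rfl
    rw [h4]
    have h5 := Real.rpow_le_rpow (z := 1 / q)
      (Finset.sum_nonneg fun j _ => by positivity) h1 (by positivity)
    rwa [Real.mul_rpow hC.le (by positivity), ← Real.rpow_mul (by positivity) q,
      mul_one_div_cancel hq.ne', Real.rpow_one] at h5

lemma rad (N : ℕ) (b : Fin N → ℝ) (k₀ : Fin N) (p : ℝ) (hp : 0 < p) (hp1 : p ≤ 1) :
    (Fintype.card (Fin N → ℤˣ) : ℝ) * (|b k₀| ^ p / 2) ≤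
      ∑ ε : Fin N → ℤˣ, |∑ k, ((ε k : ℤ) : ℝ) * b k| ^ p := by
  classical
  set H : (Fin N → ℤˣ) → ℝ := fun ε => |∑ k, ((ε k : ℤ) : ℝ) * b k| ^ p with hH
  set δ : Fin N → ℤˣ := Function.update 1 k₀ (-1) with hδ
  have h1 : ∑ ε, H (δ * ε) = ∑ ε, H ε := Equiv.sum_comp (Equiv.mulLeft δ) H
  have h2 : ∀ ε, |b k₀| ^ p ≤ H ε + H (δ * ε) := by
    intro ε
    have hd : (∑ k, ((ε k : ℤ) : ℝ) * b k) - ∑ k, (((δ * ε) k : ℤ) : ℝ) * b k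
        = 2 * (((ε k₀ : ℤ) : ℝ) * b k₀) := by
      rw [← Finset.sum_sub_distrib, Finset.sum_eq_single k₀]
      · simp [hδ]; ring
      · intro k _ hk
        simp [hδ, hk]
      · simp
    have ha : |((ε k₀ : ℤ) : ℝ)| = 1 := by
      rcases Int.units_eq_one_or (ε k₀) with h | h <;> simp [h]
    have h3 : |b k₀| ≤ |∑ k, ((ε k : ℤ) : ℝ) * b k| + |∑ k, (((δ * ε) k : ℤ) : ℝ) * b k| := by
      have h4 := abs_sub (∑ k, ((ε k : ℤ) : ℝ) * b k) (∑ k, (((δ * ε) k : ℤ) : ℝ) * b k)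
      rw [hd, abs_mul, abs_mul, ha] at h4
      have := abs_nonneg (b k₀)
      rw [abs_of_pos (by norm_num : (0:ℝ) < 2), one_mul] at h4
      linarith
    exact (Real.rpow_le_rpow (abs_nonneg _) h3 hp.le).trans
      (Real.rpow_add_le_add_rpow (abs_nonneg _) (abs_nonneg _) hp.le hp1)
  have h3 : ∑ _ε : Fin N → ℤˣ, |b k₀| ^ p ≤ ∑ ε, (H ε + H (δ * ε)) :=
    Finset.sum_le_sum fun ε _ => h2 ε
  rw [Finset.sum_add_distrib, h1, Finset.sum_const, nsmul_eq_mul, Finset.card_univ] at h3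
  linarith

lemma count_lem (N : ℕ) (z : ℝ) (hz : 0 ≤ z) (hN : z ≤ N) :
    z - 1 ≤ ∑ k : Fin N, (if ((k : ℕ) : ℝ) + 1 ≤ z then (1 : ℝ) else 0) := by
  rw [Fin.sum_univ_eq_sum_range (fun k : ℕ => if (k : ℝ) + 1 ≤ z then (1 : ℝ) else 0) N]
  have hf : ⌊z⌋₊ ≤ N := Nat.floor_le_of_le hN
  calc z - 1 ≤ (⌊z⌋₊ : ℝ) := by have := Nat.lt_floor_add_one z; linarith
    _ = ∑ k ∈ Finset.range ⌊z⌋₊, (1 : ℝ) := by simp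
    _ = ∑ k ∈ Finset.range ⌊z⌋₊, (if (k : ℝ) + 1 ≤ z then (1 : ℝ) else 0) := by
      refine Finset.sum_congr rfl fun k hk => ?_
      have h1 : k + 1 ≤ ⌊z⌋₊ := Finset.mem_range.1 hk
      have h2 := (Nat.le_floor_iff hz).1 h1
      push_cast at h2
      rw [if_pos h2]
    _ ≤ _ := by
      refine Finset.sum_le_sum_of_subset_of_nonneg (Finset.range_subset_range.2 hf) ?_
      intro k _ _
      split_ifs <;> norm_num

lemma prob_lem {ι : Type*} [Fintype ι] (μ y : ι → ℝ) (hμ : ∀ i, 0 ≤ μ i) (hμ1 : ∑ i, μ i = 1)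
    (hy : ∀ i, 0 ≤ y i) (S : ℝ) (hS : S = ∑ i, μ i * y i) (hS0 : 0 < S) (N : ℕ)
    (hN : ∀ i, y i / (S / 2) ≤ N) :
    1 / 2 ≤ ∑ g : Fin N → ι, (∏ k, μ (g k)) *
      (open Classical in
        if ∃ k : Fin N, ((k : ℕ) : ℝ) + 1 ≤ y (g k) / (S / 2) then (1 : ℝ) else 0) := by
  classical
  set Q : Fin N → ι → Prop := fun k i => ((k : ℕ) : ℝ) + 1 ≤ y i / (S / 2) with hQ
  set r : Fin N → ℝ := fun k => ∑ i, μ i * (if Q k i then (1 : ℝ) else 0) with hr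
  have htot : ∑ g : Fin N → ι, ∏ k, μ (g k) = 1 := by
    rw [← Fintype.sum_pow, hμ1, one_pow]
  have hcomp : ∑ g : Fin N → ι, (∏ k, μ (g k)) * (if ∃ k, Q k (g k) then (1 : ℝ) else 0)
      = 1 - ∑ g : Fin N → ι, ∏ k, (μ (g k) * (if Q k (g k) then (0 : ℝ) else 1)) := by
    refine Eq.trans ?_ (congrArg (fun t => t - _) htot)
    rw [← Finset.sum_sub_distrib]
    refine Finset.sum_congr rfl fun g _ => ?_
    rw [Finset.prod_mul_distrib]
    by_cases h : ∃ k, Q k (g k)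
    · obtain ⟨k, hk⟩ := h
      rw [if_pos ⟨k, hk⟩, Finset.prod_eq_zero (i := k) (f := fun k => if Q k (g k) then (0:ℝ) else 1)
        (Finset.mem_univ k) (by simp [hk])]
      ring
    · rw [if_neg h]
      push Not at h
      rw [Finset.prod_eq_one (f := fun k => if Q k (g k) then (0:ℝ) else 1) (fun k _ => by simp [h k])]
      ring
  have hprod : ∑ g : Fin N → ι, ∏ k, (μ (g k) * (if Q k (g k) then (0 : ℝ) else 1))
      = ∏ k, (1 - r k) := by
    have h0 := Finset.prod_univ_sum (fun _ : Fin N => (Finset.univ : Finset ι))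
      (fun k i => μ i * (if Q k i then (0 : ℝ) else 1))
    rw [Fintype.piFinset_univ] at h0
    rw [← h0]
    refine Finset.prod_congr rfl fun k _ => ?_
    refine Eq.trans ?_ (congrArg (fun t => t - _) hμ1)
    rw [hr, ← Finset.sum_sub_distrib]
    refine Finset.sum_congr rfl fun i _ => ?_
    split_ifs <;> ring
  have hr1 : ∀ k, r k ≤ 1 := by
    intro k
    rw [← hμ1]
    refine Finset.sum_le_sum fun i _ => ?_
    have := hμ i
    split_ifs <;> linarith
  have hsum : 1 ≤ ∑ k, r k := by
    rw [hr, Finset.sum_comm]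
    have h1 : ∀ i, μ i * (y i / (S / 2) - 1) ≤ ∑ k, μ i * (if Q k i then (1 : ℝ) else 0) := by
      intro i
      rw [← Finset.mul_sum]
      exact mul_le_mul_of_nonneg_left
        (count_lem N _ (div_nonneg (hy i) (by positivity)) (hN i)) (hμ i)
    refine le_trans (le_of_eq ?_) (Finset.sum_le_sum fun i _ => h1 i)
    have h2 : ∑ i, μ i * (y i / (S / 2) - 1) = (∑ i, μ i * y i) / (S / 2) - ∑ i, μ i := by
      rw [Finset.sum_div, ← Finset.sum_sub_distrib]
      exact Finset.sum_congr rfl fun i _ => by ring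
    rw [h2, ← hS, hμ1]
    field_simp
    norm_num
  have hexp : ∏ k, (1 - r k) ≤ 1 / 2 := by
    calc ∏ k, (1 - r k) ≤ ∏ k, Real.exp (- r k) := by
          refine Finset.prod_le_prod (fun k _ => by linarith [hr1 k]) fun k _ => ?_
          have := Real.add_one_le_exp (- r k); linarith
      _ = Real.exp (- ∑ k, r k) := by rw [← Real.exp_sum, Finset.sum_neg_distrib]
      _ ≤ Real.exp (-1) := Real.exp_le_exp.2 (by linarith)
      _ ≤ 1 / 2 := by
        rw [Real.exp_neg, one_div]
        exact inv_anti₀ (by norm_num) (by have := Real.add_one_le_exp (1:ℝ); linarith)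
  change 1 / 2 ≤ ∑ g : Fin N → ι, (∏ k, μ (g k)) * (if ∃ k, Q k (g k) then (1 : ℝ) else 0)
  rw [hcomp, hprod]
  linarith

lemma comb {ι : Type*} [Fintype ι] (μ a : ι → ℝ) (hμ : ∀ i, 0 ≤ μ i) (hμ1 : ∑ i, μ i = 1)
    (p s : ℝ) (hp : 0 < p) (hp1 : p ≤ 1) (hs : 0 < s)
    (S : ℝ) (hS : S = ∑ i, μ i * |a i| ^ s) (hS0 : 0 < S) (N : ℕ)
    (hN : ∀ i, |a i| ^ s / (S / 2) ≤ N) :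
    (Fintype.card (Fin N → ℤˣ) : ℝ) * (1 / 4 * (S / 2) ^ (p / s)) ≤
      ∑ g : Fin N → ι, (∏ k, μ (g k)) * ∑ ε : Fin N → ℤˣ,
        |∑ k, ((ε k : ℤ) : ℝ) * (((((k : ℕ) : ℝ) + 1) ^ (1 / s))⁻¹ * a (g k))| ^ p := by
  classical
  set M : ℝ := (Fintype.card (Fin N → ℤˣ) : ℝ) with hM
  have hP := prob_lem μ (fun i => |a i| ^ s) hμ hμ1 (fun i => by positivity) S hS hS0 N hN
  have hM0 : 0 ≤ M := by positivity
  have hc : 0 ≤ M * ((S / 2) ^ (p / s) / 2) := by positivity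
  calc M * (1 / 4 * (S / 2) ^ (p / s)) = (1 / 2) * (M * ((S / 2) ^ (p / s) / 2)) := by ring
    _ ≤ _ := mul_le_mul_of_nonneg_right hP hc
    _ ≤ _ := by
      rw [Finset.sum_mul]
      refine Finset.sum_le_sum fun g _ => ?_
      rw [mul_assoc]
      refine mul_le_mul_of_nonneg_left ?_ (Finset.prod_nonneg fun k _ => hμ _)
      split_ifs with h
      · obtain ⟨k, hk⟩ := h
        rw [one_mul]
        refine le_trans ?_ (rad N _ k p hp hp1)
        refine mul_le_mul_of_nonneg_left ?_ hM0
        refine div_le_div_of_nonneg_right ?_ (by norm_num)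
        have hk1 : (0:ℝ) < ((k : ℕ) : ℝ) + 1 := by positivity
        rw [le_div_iff₀ (by positivity)] at hk
        have h2 := Real.rpow_le_rpow (by positivity) hk (by positivity : 0 ≤ 1 / s)
        rw [← Real.rpow_mul (abs_nonneg _), mul_one_div_cancel hs.ne', Real.rpow_one,
          Real.mul_rpow hk1.le (by positivity)] at h2
        have h3 : (S / 2) ^ (1 / s) ≤ |((((k : ℕ) : ℝ) + 1) ^ (1 / s))⁻¹ * a (g k)| := by
          rw [abs_mul, abs_of_pos (by positivity), inv_mul_eq_div, le_div_iff₀ (by positivity)]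
          linarith
        have h4 := Real.rpow_le_rpow (by positivity) h3 hp.le
        rw [← Real.rpow_mul (by positivity)] at h4
        rwa [one_div_mul_eq_div] at h4
      · rw [zero_mul]
        exact Finset.sum_nonneg fun ε _ => by positivity

lemma ps_up {X Y : Type*} [MetricSpace X] [MetricSpace Y] (x₀ : X) (p s C : ℝ) (hC : 0 < C)
    (hp : 0 < p) (hps : p ≤ s) (T : X → Y) (h : PS x₀ p C T) :
    PS x₀ s ((2 * C) ^ (s / p)) T := by
  intro m v x' x'' W hv hW
  obtain ⟨ι, _, μ, f, hμ, hμ1, hf, hd⟩ := pietsch x₀ p C hC T h m x' x''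
  have h1 : ∀ j, dist (T (x' j)) (T (x'' j)) ^ s ≤
      (2 * C) ^ (s / p) * ∑ i, μ i * |f i (x' j) - f i (x'' j)| ^ s := by
    intro j
    have h2 := Real.rpow_le_rpow (by positivity) (hd j) (div_nonneg (hp.le.trans hps) hp.le : 0 ≤ s / p)
    have h0 : 0 ≤ ∑ i, μ i * |f i (x' j) - f i (x'' j)| ^ p :=
      Finset.sum_nonneg fun i _ => mul_nonneg (hμ i) (by positivity)
    have e : p * (s / p) = s := by field_simp
    rw [← Real.rpow_mul dist_nonneg, e, Real.mul_rpow (by positivity) h0] at h2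
    refine h2.trans (mul_le_mul_of_nonneg_left ?_ (by positivity))
    refine (Real.rpow_arith_mean_le_arith_mean_rpow Finset.univ μ _ (fun i _ => hμ i) hμ1
      (fun i _ => by positivity) ((one_le_div hp).2 hps)).trans (le_of_eq ?_)
    refine Finset.sum_congr rfl fun i _ => ?_
    rw [← Real.rpow_mul (abs_nonneg _), e]
  calc ∑ j, v j * dist (T (x' j)) (T (x'' j)) ^ s
      ≤ ∑ j, v j * ((2 * C) ^ (s / p) * ∑ i, μ i * |f i (x' j) - f i (x'' j)| ^ s) :=
        Finset.sum_le_sum fun j _ => mul_le_mul_of_nonneg_left (h1 j) (hv j)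
    _ = (2 * C) ^ (s / p) * ∑ i, μ i * ∑ j, v j * |f i (x' j) - f i (x'' j)| ^ s := by
        simp only [Finset.mul_sum]
        rw [Finset.sum_comm]
        exact Finset.sum_congr rfl fun i _ => Finset.sum_congr rfl fun j _ => by ring
    _ ≤ (2 * C) ^ (s / p) * ∑ i, μ i * W := by
        refine mul_le_mul_of_nonneg_left ?_ (by positivity)
        exact Finset.sum_le_sum fun i _ => mul_le_mul_of_nonneg_left (hW _ (hf i)) (hμ i)
    _ = _ := by rw [← Finset.sum_mul, hμ1, one_mul]

lemma comb_mem {X : Type*} [MetricSpace X] (x₀ : X) (N : ℕ) (c : Fin N → ℝ) (f : Fin N → X → ℝ)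
    (hf : ∀ k, f k ∈ dualBall X x₀) (hc : ∑ k, |c k| ≤ 1) :
    (fun x => ∑ k, c k * f k x) ∈ dualBall X x₀ := by
  refine ⟨LipschitzWith.of_dist_le_mul fun x y => ?_, ?_⟩
  · rw [Real.dist_eq, ← Finset.sum_sub_distrib]
    refine (Finset.abs_sum_le_sum_abs _ _).trans ?_
    calc ∑ k, |c k * f k x - c k * f k y| ≤ ∑ k, |c k| * dist x y := by
          refine Finset.sum_le_sum fun k _ => ?_
          rw [← mul_sub, abs_mul]
          refine mul_le_mul_of_nonneg_left ?_ (abs_nonneg _)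
          have := (hf k).1.dist_le_mul x y
          simpa [Real.dist_eq] using this
      _ = (∑ k, |c k|) * dist x y := by rw [Finset.sum_mul]
      _ ≤ _ := by
        refine mul_le_mul_of_nonneg_right ?_ dist_nonneg
        simpa using hc
  · exact Finset.sum_eq_zero fun k _ => by rw [(hf k).2, mul_zero]

lemma zeta_bd (s : ℝ) (hs : 0 < s) (hs1 : s < 1) :
    ∃ Z : ℝ, 0 < Z ∧ ∀ N : ℕ, ∑ k : Fin N, ((((k : ℕ) : ℝ) + 1) ^ (1 / s))⁻¹ ≤ Z := by
  have h1 : Summable fun n : ℕ => ((n : ℝ) ^ (1 / s))⁻¹ :=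
    Real.summable_nat_rpow_inv.2 ((one_lt_div hs).2 hs1)
  have h2 : Summable fun n : ℕ => (((n : ℝ) + 1) ^ (1 / s))⁻¹ := by
    have := (_root_.summable_nat_add_iff 1).2 h1
    simpa using this
  refine ⟨(∑' n : ℕ, (((n : ℝ) + 1) ^ (1 / s))⁻¹) + 1, ?_, fun N => ?_⟩
  · have : 0 ≤ ∑' n : ℕ, (((n : ℝ) + 1) ^ (1 / s))⁻¹ := tsum_nonneg fun n => by positivity
    linarith
  · rw [Fin.sum_univ_eq_sum_range (fun k : ℕ => (((k : ℝ) + 1) ^ (1 / s))⁻¹) N]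
    have := h2.sum_le_tsum (Finset.range N) (fun n _ => by positivity)
    linarith

lemma ps_down {X Y : Type*} [MetricSpace X] [MetricSpace Y] (x₀ : X) (p s C : ℝ) (hC : 0 < C)
    (hp : 0 < p) (hp1 : p ≤ 1) (hs : 0 < s) (hs1 : s < 1) (T : X → Y) (h : PS x₀ s C T) :
    ∃ C' : ℝ, 0 < C' ∧ PS x₀ p C' T := by
  obtain ⟨Z, hZ, hZN⟩ := zeta_bd s hs hs1
  refine ⟨4 * (4 * C) ^ (p / s) * Z ^ p, by positivity, ?_⟩
  intro m v x' x'' W hv hW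
  obtain ⟨ι, _, μ, f, hμ, hμ1, hf, hd⟩ := pietsch x₀ s C hC T h m x' x''
  set a : Fin m → ι → ℝ := fun j i => f i (x' j) - f i (x'' j) with ha
  set S : Fin m → ℝ := fun j => ∑ i, μ i * |a j i| ^ s with hS
  have hSn : ∀ j, 0 ≤ S j := fun j =>
    Finset.sum_nonneg fun i _ => mul_nonneg (hμ i) (by positivity)
  obtain ⟨N, hN⟩ : ∃ N : ℕ, ∀ j i, |a j i| ^ s / (S j / 2) ≤ N := by
    have : ∀ᶠ N : ℕ in Filter.atTop, ∀ j i, |a j i| ^ s / (S j / 2) ≤ (N : ℝ) :=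
      Filter.eventually_all.2 fun j => Filter.eventually_all.2 fun i =>
        tendsto_natCast_atTop_atTop.eventually_ge_atTop _
    exact this.exists
  set M : ℝ := (Fintype.card (Fin N → ℤˣ) : ℝ) with hM
  have hM0 : 0 < M := by
    rw [hM]; exact_mod_cast Fintype.card_pos
  set c : Fin N → ℝ := fun k => ((((k : ℕ) : ℝ) + 1) ^ (1 / s))⁻¹ with hc
  have hc0 : ∀ k, 0 ≤ c k := fun k => by positivity
  set G : Fin m → (Fin N → ι) → (Fin N → ℤˣ) → ℝ := fun j g ε =>
    |∑ k, ((ε k : ℤ) : ℝ) * (c k * a j (g k))| ^ p with hG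
  have hlow : ∀ j, M * dist (T (x' j)) (T (x'' j)) ^ p ≤
      4 * (4 * C) ^ (p / s) * ∑ g : Fin N → ι, (∏ k, μ (g k)) * ∑ ε, G j g ε := by
    intro j
    have hR : 0 ≤ ∑ g : Fin N → ι, (∏ k, μ (g k)) * ∑ ε, G j g ε :=
      Finset.sum_nonneg fun g _ => mul_nonneg (Finset.prod_nonneg fun k _ => hμ _)
        (Finset.sum_nonneg fun ε _ => by positivity)
    have h2 := Real.rpow_le_rpow (by positivity) (hd j) (by positivity : 0 ≤ p / s)
    have e : s * (p / s) = p := by field_simp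
    rw [← Real.rpow_mul dist_nonneg, e] at h2
    change _ ≤ (2 * C * S j) ^ (p / s) at h2
    have e2 : 2 * C * S j = (4 * C) * (S j / 2) := by ring
    rw [e2, Real.mul_rpow (by positivity) (by have := hSn j; positivity)] at h2
    rcases (hSn j).eq_or_lt with h0 | h0
    · rw [← h0, zero_div, Real.zero_rpow (by positivity), mul_zero] at h2
      have h3 : M * dist (T (x' j)) (T (x'' j)) ^ p ≤ 0 :=
        mul_nonpos_of_nonneg_of_nonpos hM0.le h2
      exact h3.trans (by positivity)
    · have h3 := comb μ (a j) hμ hμ1 p s hp hp1 hs (S j) rfl h0 N (hN j)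
      calc M * dist (T (x' j)) (T (x'' j)) ^ p ≤ M * ((4 * C) ^ (p / s) * (S j / 2) ^ (p / s)) :=
            mul_le_mul_of_nonneg_left h2 hM0.le
        _ = 4 * (4 * C) ^ (p / s) * (M * (1 / 4 * (S j / 2) ^ (p / s))) := by ring
        _ ≤ _ := mul_le_mul_of_nonneg_left h3 (by positivity)
  have hup : ∀ g ε, ∑ j, v j * G j g ε ≤ Z ^ p * W := by
    intro g ε
    have hmem := comb_mem x₀ N (fun k => ((ε k : ℤ) : ℝ) * c k / Z) (fun k => f (g k))
      (fun k => hf _) (by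
        have : ∀ k, |((ε k : ℤ) : ℝ) * c k / Z| = c k / Z := by
          intro k
          have h1 : |((ε k : ℤ) : ℝ)| = 1 := by
            rcases Int.units_eq_one_or (ε k) with h | h <;> simp [h]
          rw [abs_div, abs_mul, h1, one_mul, abs_of_nonneg (hc0 k), abs_of_pos hZ]
        simp only [this]
        rw [← Finset.sum_div, div_le_one hZ]
        exact hZN N)
    have h1 := hW _ hmem
    have h2 : ∀ j, G j g ε = Z ^ p * |(∑ k, ((ε k : ℤ) : ℝ) * c k / Z * f (g k) (x' j)) -
        ∑ k, ((ε k : ℤ) : ℝ) * c k / Z * f (g k) (x'' j)| ^ p := by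
      intro j
      rw [← Real.mul_rpow hZ.le (abs_nonneg _), ← Finset.sum_sub_distrib]
      simp only [hG]
      congr 1
      rw [← abs_of_pos hZ, ← abs_mul, abs_of_pos hZ, Finset.mul_sum]
      congr 1
      refine Finset.sum_congr rfl fun k _ => ?_
      simp only [ha]
      field_simp
    calc ∑ j, v j * G j g ε = Z ^ p * ∑ j, v j *
          |(∑ k, ((ε k : ℤ) : ℝ) * c k / Z * f (g k) (x' j)) -
            ∑ k, ((ε k : ℤ) : ℝ) * c k / Z * f (g k) (x'' j)| ^ p := by
          rw [Finset.mul_sum]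
          exact Finset.sum_congr rfl fun j _ => by rw [h2 j]; ring
      _ ≤ _ := mul_le_mul_of_nonneg_left h1 (by positivity)
  have htot : ∑ g : Fin N → ι, ∏ k, μ (g k) = 1 := by
    rw [← Fintype.sum_pow, hμ1, one_pow]
  refine le_of_mul_le_mul_left ?_ hM0
  calc M * ∑ j, v j * dist (T (x' j)) (T (x'' j)) ^ p
      = ∑ j, v j * (M * dist (T (x' j)) (T (x'' j)) ^ p) := by
        rw [Finset.mul_sum]; exact Finset.sum_congr rfl fun j _ => by ring
    _ ≤ ∑ j, v j * (4 * (4 * C) ^ (p / s) * ∑ g : Fin N → ι, (∏ k, μ (g k)) * ∑ ε, G j g ε) :=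
        Finset.sum_le_sum fun j _ => mul_le_mul_of_nonneg_left (hlow j) (hv j)
    _ = 4 * (4 * C) ^ (p / s) * ∑ g : Fin N → ι, (∏ k, μ (g k)) * ∑ ε, ∑ j, v j * G j g ε := by
        have : ∀ g : Fin N → ι, ∑ ε, ∑ j, v j * G j g ε = ∑ j, v j * ∑ ε, G j g ε := by
          intro g
          rw [Finset.sum_comm]
          exact Finset.sum_congr rfl fun j _ => by rw [Finset.mul_sum]
        simp only [this]
        simp only [Finset.mul_sum (s := (Finset.univ : Finset (Fin m))),
          Finset.mul_sum (s := (Finset.univ : Finset (Fin N → ι)))]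
        rw [Finset.sum_comm]
        exact Finset.sum_congr rfl fun g _ => Finset.sum_congr rfl fun j _ => by ring
    _ ≤ 4 * (4 * C) ^ (p / s) * ∑ g : Fin N → ι, (∏ k, μ (g k)) * (M * (Z ^ p * W)) := by
        refine mul_le_mul_of_nonneg_left ?_ (by positivity)
        refine Finset.sum_le_sum fun g _ => ?_
        refine mul_le_mul_of_nonneg_left ?_ (Finset.prod_nonneg fun k _ => hμ _)
        refine (Finset.sum_le_sum fun ε _ => hup g ε).trans (le_of_eq ?_)
        rw [Finset.sum_const, nsmul_eq_mul, Finset.card_univ]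
    _ = M * (4 * (4 * C) ^ (p / s) * Z ^ p * W) := by
        rw [← Finset.sum_mul, htot]; ring

/-- for `0 < p < s < 1`, a Lipschitz map is Lipschitz `(p,m^L(p;p))`-summing
(i.e. Lipschitz `p`-summing) iff it is Lipschitz `(s,m^L(s;s))`-summing (i.e. Lipschitz
`s`-summing). -/
theorem stmt18 {X Y : Type*} [MetricSpace X] [MetricSpace Y] (x₀ : X)
    (p s : ℝ≥0∞) (hp : 0 < p) (hps : p < s) (hs : s < 1)
    (T : X → Y) (K : ℝ≥0) (hT : LipschitzWith K T) :
    LipPMixed x₀ p p p T ↔ LipPMixed x₀ s s s T := by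
  have hp0 : p ≠ 0 := hp.ne'
  have hs0 : s ≠ 0 := (hp.trans hps).ne'
  have hst : s ≠ ∞ := (hs.trans ENNReal.one_lt_top).ne
  have hpt : p ≠ ∞ := (hps.trans (hs.trans ENNReal.one_lt_top)).ne
  have hpr : 0 < p.toReal := ENNReal.toReal_pos hp0 hpt
  have hsr : 0 < s.toReal := ENNReal.toReal_pos hs0 hst
  have hpsr : p.toReal < s.toReal := (ENNReal.toReal_lt_toReal hpt hst).2 hps
  have hsr1 : s.toReal < 1 := by
    have := (ENNReal.toReal_lt_toReal hst ENNReal.one_ne_top).2 hs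
    simpa using this
  rw [lip_iff x₀ p hp0 hpt, lip_iff x₀ s hs0 hst]
  constructor
  · rintro ⟨C, hC, h⟩
    exact ⟨_, by positivity, ps_up x₀ _ _ C hC hpr hpsr.le T h⟩
  · rintro ⟨C, hC, h⟩
    exact ps_down x₀ _ _ C hC hpr (hpsr.trans hsr1).le hsr hsr1 T h
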